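/- arXiv:2407.08846 — 5 statements merged into one kernel-verified Lean document; each statement's English description precedes it below -/
import Mathlib

section
/- Let p > 1 and β ≥ 1. For every C₀ > 0 there exists C₁ > 0, depending only on p, β and C₀ (one may take C₁ = C₀^{1/β} if C₁ ≥ 1, and in general C₁ = max(1, C₀)^{1/γ} with γ = min(β, p−2+β) > 0), such that for all s, t, μ ≥ 0: if (μ + t)^{p−2} t^β ≤ C₀ (μ + s)^{p−2} s^β, then t ≤ C₁ s. -/
theorem Real.rpow_min_le_rpow_mul_rpow {r l : ℝ} (q β : ℝ) (hr : 1 ≤ r) (hrl : r ≤ l) :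
    l ^ min β (q + β) ≤ r ^ q * l ^ β := by
  have hr0 : 0 < r := by linarith
  have hl0 : 0 < l := by linarith
  have hl1 : 1 ≤ l := hr.trans hrl
  rcases le_total 0 q with hq | hq
  · calc l ^ min β (q + β) ≤ l ^ β := Real.rpow_le_rpow_of_exponent_le hl1 (min_le_left _ _)
      _ ≤ r ^ q * l ^ β :=
        le_mul_of_one_le_left (Real.rpow_nonneg hl0.le _) (Real.one_le_rpow hr hq)
  · calc l ^ min β (q + β) ≤ l ^ (q + β) :=
          Real.rpow_le_rpow_of_exponent_le hl1 (min_le_right _ _)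
      _ = l ^ q * l ^ β := Real.rpow_add hl0 _ _
      _ ≤ r ^ q * l ^ β :=
        mul_le_mul_of_nonneg_right (Real.rpow_le_rpow_of_nonpos hr0 hrl hq)
          (Real.rpow_nonneg hl0.le _)


/-- For `p > 1`, `β ≥ 1` and any `C₀ > 0` there is `C₁ > 0`,
depending only on `p`, `β` and `C₀`, such that for all `s, t, μ ≥ 0`:
if `(μ + t) ^ (p - 2) * t ^ β ≤ C₀ * (μ + s) ^ (p - 2) * s ^ β` then `t ≤ C₁ * s`. -/
theorem comparison_weight_rpow (p β : ℝ) (hp : 1 < p) (hβ : 1 ≤ β) :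
    ∀ C₀ : ℝ, 0 < C₀ → ∃ C₁ : ℝ, 0 < C₁ ∧
      ∀ s t μ : ℝ, 0 ≤ s → 0 ≤ t → 0 ≤ μ →
        (μ + t) ^ (p - 2) * t ^ β ≤ C₀ * ((μ + s) ^ (p - 2) * s ^ β) →
        t ≤ C₁ * s := by
  intro C₀ _
  set γ := min β (p - 2 + β) with hγ
  have hγ0 : 0 < γ := lt_min (by linarith) (by linarith)
  have hM : 0 < max 1 C₀ := lt_max_of_lt_left one_pos
  refine ⟨(max 1 C₀) ^ γ⁻¹, Real.rpow_pos_of_pos hM _, fun s t μ hs ht hμ h => ?_⟩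
  have hC : 1 ≤ (max 1 C₀) ^ γ⁻¹ := Real.one_le_rpow (le_max_left _ _) (inv_nonneg.2 hγ0.le)
  by_contra! hlt
  have ht0 : 0 < t := lt_of_le_of_lt (mul_nonneg (zero_le_one.trans hC) hs) hlt
  rcases hs.eq_or_lt with rfl | hs0
  · rw [Real.zero_rpow (by linarith : β ≠ 0), mul_zero, mul_zero] at h
    exact h.not_gt (by positivity)
  have hst : s ≤ t := (le_mul_of_one_le_left hs hC).trans hlt.le
  have hμs : 0 < μ + s := by linarith
  have hμt : 0 < μ + t := by linarith
  have hr : 1 ≤ (μ + t) / (μ + s) := by rw [one_le_div hμs]; linarith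
  have hrl : (μ + t) / (μ + s) ≤ t / s := by
    rw [div_le_div_iff₀ hμs hs0]
    nlinarith [mul_le_mul_of_nonneg_left hst hμ]
  have hle : (t / s) ^ γ ≤ max 1 C₀ := by
    refine (Real.rpow_min_le_rpow_mul_rpow (p - 2) β hr hrl).trans
      (le_trans ?_ (le_max_right _ _))
    rw [Real.div_rpow hμt.le hμs.le, Real.div_rpow ht hs, div_mul_div_comm,
      div_le_iff₀ (by positivity)]
    exact h
  have hgt : (max 1 C₀) ^ γ⁻¹ < t / s := by rwa [lt_div_iff₀ hs0]
  exact hle.not_gt ((Real.rpow_inv_lt_iff_of_pos hM.le (by positivity) hγ0).1 hgt)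
end

section
/- Let d ≥ 1, p > 1, and let c ∈ C¹(ℝ^d) be convex. Then the following are equivalent up to changing the constant: (i) there exists Λ > 0 such that ⟨∇c(x) − ∇c(y), x − y⟩ ≥ Λ⁻¹ (|x|+|y|)^{p−2} |x−y|² for all x, y ∈ ℝ^d; (ii) there exists Λ′ > 0 such that c(x) ≥ c(y) + ⟨∇c(y), x − y⟩ + Λ′⁻¹ (|x|+|y|)^{p−2} |x−y|² for all x, y ∈ ℝ^d. More precisely, (i) with constant Λ implies (ii) with a constant Λ′ depending only on Λ and p, and conversely (ii) with constant Λ′ implies (i) with a constant Λ depending only on Λ′ and p. -/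
open scoped RealInnerProductSpace

/-- The graph of a differentiable convex function lies above its tangent hyperplanes. -/
theorem ConvexOn.add_inner_gradient_le {E : Type*} [NormedAddCommGroup E] [InnerProductSpace ℝ E]
    [CompleteSpace E] {c : E → ℝ} (hc : ConvexOn ℝ Set.univ c) {y : E}
    (hd : DifferentiableAt ℝ c y) (x : E) :
    c y + ⟪gradient c y, x - y⟫ ≤ c x := by
  have hconv : ConvexOn ℝ Set.univ (c ∘ AffineMap.lineMap (k := ℝ) y x) := by
    simpa using hc.comp_affineMap (AffineMap.lineMap (k := ℝ) y x)
  have hderiv : HasDerivAt (c ∘ AffineMap.lineMap (k := ℝ) y x) ⟪gradient c y, x - y⟫ 0 := by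
    have hg : HasFDerivAt c (InnerProductSpace.toDual ℝ E (gradient c y))
        (AffineMap.lineMap y x (0 : ℝ)) := by
      simpa using hd.hasGradientAt.hasFDerivAt
    simpa using hg.comp_hasDerivAt (0 : ℝ) AffineMap.hasDerivAt_lineMap
  have h := hconv.le_slope_of_hasDerivAt (Set.mem_univ 0) (Set.mem_univ 1) one_pos hderiv
  simp only [slope_def_field, Function.comp_apply, AffineMap.lineMap_apply_one,
    AffineMap.lineMap_apply_zero, sub_zero, div_one] at h
  linarith

/-- Real powers of two positive numbers within a factor two of each other are comparable. -/
theorem Real.two_rpow_neg_abs_mul_rpow_le {s t : ℝ} (q : ℝ) (hs : 0 < s) (hst : s / 2 ≤ t)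
    (hts : t ≤ 2 * s) : (2 : ℝ) ^ (-|q|) * s ^ q ≤ t ^ q := by
  have ht : 0 < t := by linarith
  rcases le_total 0 q with hq | hq
  · calc (2 : ℝ) ^ (-|q|) * s ^ q = (s / 2) ^ q := by
          rw [abs_of_nonneg hq, Real.rpow_neg two_pos.le, Real.div_rpow hs.le two_pos.le]
          ring
      _ ≤ t ^ q := Real.rpow_le_rpow (by positivity) hst hq
  · calc (2 : ℝ) ^ (-|q|) * s ^ q = (2 * s) ^ q := by
          rw [abs_of_nonpos hq, neg_neg, Real.mul_rpow two_pos.le hs.le]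
      _ ≤ t ^ q := Real.rpow_le_rpow_of_nonpos ht hts hq

/-- Replacing a point by its midpoint with `y` changes the weight `(‖x‖ + ‖y‖) ^ q` by at most
a constant factor. -/
theorem two_rpow_neg_abs_mul_rpow_le_midpoint {E : Type*} [NormedAddCommGroup E]
    [NormedSpace ℝ E] (q : ℝ) {x y : E} (hxy : x ≠ y) :
    (2 : ℝ) ^ (-|q|) * (‖x‖ + ‖y‖) ^ q ≤ (‖midpoint ℝ x y‖ + ‖y‖) ^ q := by
  have hx : x = (2 : ℝ) • midpoint ℝ x y - y := by
    rw [midpoint_eq_smul_add, smul_smul]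
    norm_num
  have hnorm : ‖x‖ ≤ 2 * ‖midpoint ℝ x y‖ + ‖y‖ := by
    calc ‖x‖ = ‖(2 : ℝ) • midpoint ℝ x y - y‖ := congrArg _ hx
      _ ≤ ‖(2 : ℝ) • midpoint ℝ x y‖ + ‖y‖ := norm_sub_le _ _
      _ = 2 * ‖midpoint ℝ x y‖ + ‖y‖ := by rw [norm_smul]; norm_num
  have hmid : 2 * ‖midpoint ℝ x y‖ ≤ ‖x‖ + ‖y‖ := by
    calc 2 * ‖midpoint ℝ x y‖ = ‖x + y‖ := by
          rw [midpoint_eq_smul_add, norm_smul]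
          norm_num
          ring
      _ ≤ ‖x‖ + ‖y‖ := norm_add_le _ _
  have hpos : 0 < ‖x‖ + ‖y‖ := by
    have := norm_sub_le x y
    have := norm_pos_iff.mpr (sub_ne_zero.mpr hxy)
    linarith
  have := norm_nonneg x
  exact Real.two_rpow_neg_abs_mul_rpow_le q hpos (by linarith) (by linarith)

/-- The convexity gap at `x` dominates the monotonicity gap of the gradient between `y` and the
midpoint of `x` and `y`. -/
theorem ConvexOn.add_inner_gradient_midpoint_le {E : Type*} [NormedAddCommGroup E]
    [InnerProductSpace ℝ E] [CompleteSpace E] {c : E → ℝ} (hc : ConvexOn ℝ Set.univ c)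
    (hd : Differentiable ℝ c) (x y : E) :
    c y + ⟪gradient c y, x - y⟫ +
      ⟪gradient c (midpoint ℝ x y) - gradient c y, midpoint ℝ x y - y⟫ ≤ c x := by
  have h₁ := hc.add_inner_gradient_le (hd (midpoint ℝ x y)) x
  have h₂ := hc.add_inner_gradient_le (hd y) (midpoint ℝ x y)
  have hright : midpoint ℝ x y - y = (2⁻¹ : ℝ) • (x - y) := by
    simp
  have hleft : x - midpoint ℝ x y = (2⁻¹ : ℝ) • (x - y) := by
    simp
  rw [hleft, inner_smul_right] at h₁
  rw [hright, inner_smul_right] at h₂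
  rw [hright, inner_smul_right, inner_sub_left]
  linarith

/-- For a convex `C¹` function `c` on `ℝ^d`, the strong monotonicity
of `∇c` with weight `(|x|+|y|)^(p-2)` is equivalent (up to changing the constant,
the new constant depending only on the old one and `p`) to the corresponding
strong convexity inequality. -/
theorem monotonicity_iff_strong_convexity (d : ℕ) (hd : 1 ≤ d) (p : ℝ) (hp : 1 < p) :
    (∀ Λ : ℝ, 0 < Λ → ∃ Λ' : ℝ, 0 < Λ' ∧
      ∀ c : EuclideanSpace ℝ (Fin d) → ℝ, ConvexOn ℝ Set.univ c → ContDiff ℝ 1 c →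
        (∀ x y : EuclideanSpace ℝ (Fin d),
          Λ⁻¹ * (‖x‖ + ‖y‖) ^ (p - 2) * ‖x - y‖ ^ 2 ≤
            ⟪gradient c x - gradient c y, x - y⟫) →
        (∀ x y : EuclideanSpace ℝ (Fin d),
          c y + ⟪gradient c y, x - y⟫ + Λ'⁻¹ * (‖x‖ + ‖y‖) ^ (p - 2) * ‖x - y‖ ^ 2 ≤ c x)) ∧
    (∀ Λ' : ℝ, 0 < Λ' → ∃ Λ : ℝ, 0 < Λ ∧
      ∀ c : EuclideanSpace ℝ (Fin d) → ℝ, ConvexOn ℝ Set.univ c → ContDiff ℝ 1 c →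
        (∀ x y : EuclideanSpace ℝ (Fin d),
          c y + ⟪gradient c y, x - y⟫ + Λ'⁻¹ * (‖x‖ + ‖y‖) ^ (p - 2) * ‖x - y‖ ^ 2 ≤ c x) →
        (∀ x y : EuclideanSpace ℝ (Fin d),
          Λ⁻¹ * (‖x‖ + ‖y‖) ^ (p - 2) * ‖x - y‖ ^ 2 ≤
            ⟪gradient c x - gradient c y, x - y⟫)) := by
  constructor
  · intro Λ hΛ
    refine ⟨4 * 2 ^ |p - 2| * Λ, by positivity, fun c hc hdiff hmono x y => ?_⟩
    rcases eq_or_ne x y with rfl | hxy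
    · simp
    have hgap := hc.add_inner_gradient_midpoint_le (hdiff.differentiable one_ne_zero) x y
    have hm := hmono (midpoint ℝ x y) y
    have hnorm : ‖midpoint ℝ x y - y‖ = 2⁻¹ * ‖x - y‖ := by
      rw [midpoint_sub_right, norm_smul]
      norm_num
    have hle : (4 * 2 ^ |p - 2| * Λ)⁻¹ * (‖x‖ + ‖y‖) ^ (p - 2) * ‖x - y‖ ^ 2 ≤
        Λ⁻¹ * (‖midpoint ℝ x y‖ + ‖y‖) ^ (p - 2) * ‖midpoint ℝ x y - y‖ ^ 2 := by
      calc (4 * 2 ^ |p - 2| * Λ)⁻¹ * (‖x‖ + ‖y‖) ^ (p - 2) * ‖x - y‖ ^ 2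
          = Λ⁻¹ * (2 ^ (-|p - 2|) * (‖x‖ + ‖y‖) ^ (p - 2)) * ‖midpoint ℝ x y - y‖ ^ 2 := by
            rw [hnorm, Real.rpow_neg two_pos.le, mul_inv, mul_inv]
            ring
        _ ≤ _ := by
            gcongr
            exact two_rpow_neg_abs_mul_rpow_le_midpoint (p - 2) hxy
    linarith
  · intro Λ hΛ
    refine ⟨Λ, hΛ, fun c _ _ hconv x y => ?_⟩
    have h₁ := hconv x y
    have h₂ := hconv y x
    rw [add_comm ‖y‖, norm_sub_rev y x, ← neg_sub x y, inner_neg_right] at h₂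
    have hnonneg : 0 ≤ Λ⁻¹ * (‖x‖ + ‖y‖) ^ (p - 2) * ‖x - y‖ ^ 2 := by positivity
    rw [inner_sub_left]
    linarith
end

section
/- Let d ≥ 1, p > 1, and let c ∈ C¹(ℝ^d) be convex. Then the following are equivalent up to changing the constant: (i) there exists Λ > 0 such that c(x) ≥ c(y) + ⟨∇c(y), x − y⟩ + Λ⁻¹ (|x|+|y|)^{p−2} |x−y|² for all x, y ∈ ℝ^d; (ii) there exists Λ′ > 0 such that c(λx + (1−λ)y) ≤ λ c(x) + (1−λ) c(y) − Λ′⁻¹ λ(1−λ) (|x|+|y|)^{p−2} |x−y|² for all x, y ∈ ℝ^d and all λ ∈ [0,1]. More precisely, (i) with constant Λ implies (ii) with a constant Λ′ depending only on Λ and p, and conversely. -/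
open scoped RealInnerProductSpace

/-- Real powers of comparable positive numbers are comparable. -/
theorem two_rpow_neg_abs_mul_rpow_le {S T : ℝ} (q : ℝ) (hS : 0 < S) (hST : S ≤ 2 * T)
    (hTS : T ≤ 2 * S) : (2 : ℝ) ^ (-|q|) * S ^ q ≤ T ^ q := by
  have hT : 0 < T := by linarith
  rcases le_total 0 q with hq | hq
  · rw [abs_of_nonneg hq, Real.rpow_neg zero_le_two, inv_mul_le_iff₀ (by positivity),
      ← Real.mul_rpow zero_le_two hT.le]
    exact Real.rpow_le_rpow hS.le hST hq
  · rw [abs_of_nonpos hq, neg_neg, ← Real.mul_rpow zero_le_two hS.le]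
    exact Real.rpow_le_rpow_of_nonpos hT hTS hq

section StrongConvexity

variable {E : Type*} [NormedAddCommGroup E] [InnerProductSpace ℝ E]

/-- For `t ≤ 1 / 2`, the point `t • x + (1 - t) • y` is such that its norm plus `‖x‖` is comparable
to `‖x‖ + ‖y‖`. -/
theorem norm_add_norm_rpow_le_of_le_half (q : ℝ) {x y : E} (hxy : x ≠ y) {t : ℝ} (ht : 0 ≤ t)
    (ht' : t ≤ 1 / 2) :
    (2 : ℝ) ^ (-|q|) * (‖x‖ + ‖y‖) ^ q ≤ (‖x‖ + ‖t • x + (1 - t) • y‖) ^ q := by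
  have hx : ‖t • x‖ = t * ‖x‖ := norm_smul_of_nonneg ht x
  have hy : ‖(1 - t) • y‖ = (1 - t) * ‖y‖ := norm_smul_of_nonneg (by linarith) y
  have hpos : 0 < ‖x‖ + ‖y‖ :=
    (norm_pos_iff.2 (sub_ne_zero.2 hxy)).trans_le (norm_sub_le x y)
  have hupper := norm_add_le (t • x) ((1 - t) • y)
  have hlower := norm_sub_le (t • x + (1 - t) • y) (t • x)
  rw [add_sub_cancel_left] at hlower
  rw [hx, hy] at hupper hlower
  have hx0 := norm_nonneg x
  have hy0 := norm_nonneg y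
  apply two_rpow_neg_abs_mul_rpow_le q hpos <;> nlinarith

/-- The uniform convexity inequality at weight `t ≤ 1 / 2`, deduced from a strong convexity
inequality with slopes `g`. -/
theorem uniform_convexity_of_strong_convexity_of_le_half {q Λ : ℝ} (hΛ : 0 < Λ) {c : E → ℝ}
    {g : E → E}
    (h : ∀ x y, c y + ⟪g y, x - y⟫ + Λ⁻¹ * (‖x‖ + ‖y‖) ^ q * ‖x - y‖ ^ 2 ≤ c x)
    (x y : E) {t : ℝ} (ht : 0 ≤ t) (ht' : t ≤ 1 / 2) :
    c (t • x + (1 - t) • y) ≤ t * c x + (1 - t) * c y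
      - (2 * 2 ^ |q| * Λ)⁻¹ * t * (1 - t) * (‖x‖ + ‖y‖) ^ q * ‖x - y‖ ^ 2 := by
  rcases eq_or_ne x y with rfl | hxy
  · have hx : t • x + (1 - t) • x = x := by module
    simp only [hx, sub_self, norm_zero]
    linarith
  have hcomp := norm_add_norm_rpow_le_of_le_half q hxy ht ht'
  set z := t • x + (1 - t) • y with hz
  have hxz : x - z = (1 - t) • (x - y) := by rw [hz]; module
  have hyz : y - z = (-t) • (x - y) := by rw [hz]; module
  have h1 := h x z
  have h2 : c z + ⟪g z, y - z⟫ ≤ c y :=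
    (le_add_of_nonneg_right (by positivity)).trans (h y z)
  rw [hxz, inner_smul_right, norm_smul_of_nonneg (by linarith), mul_pow] at h1
  rw [hyz, inner_smul_right] at h2
  have hconst : (2 * 2 ^ |q| * Λ)⁻¹ = Λ⁻¹ * (2 : ℝ) ^ (-|q|) * (1 / 2) := by
    rw [Real.rpow_neg zero_le_two]
    field_simp
  have hcoef : Λ⁻¹ * (2 : ℝ) ^ (-|q|) * (1 / 2) * t * (1 - t) * (‖x‖ + ‖y‖) ^ q * ‖x - y‖ ^ 2
      ≤ t * (Λ⁻¹ * (‖x‖ + ‖z‖) ^ q * ((1 - t) ^ 2 * ‖x - y‖ ^ 2)) := by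
    have h1t : 0 ≤ 1 - t := by linarith
    calc _ = Λ⁻¹ * t * (1 - t) * ‖x - y‖ ^ 2 * (1 / 2 * (2 ^ (-|q|) * (‖x‖ + ‖y‖) ^ q)) := by ring
      _ ≤ Λ⁻¹ * t * (1 - t) * ‖x - y‖ ^ 2 * ((1 - t) * (‖x‖ + ‖z‖) ^ q) := by
        gcongr
        linarith
      _ = _ := by ring
  rw [hconst]
  have h1' := mul_le_mul_of_nonneg_left h1 ht
  have h2' := mul_le_mul_of_nonneg_left h2 (by linarith : 0 ≤ 1 - t)
  linarith

/-- A strong convexity inequality with slopes `g` implies uniform convexity along segments. -/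
theorem uniform_convexity_of_strong_convexity {q Λ : ℝ} (hΛ : 0 < Λ) {c : E → ℝ} {g : E → E}
    (h : ∀ x y, c y + ⟪g y, x - y⟫ + Λ⁻¹ * (‖x‖ + ‖y‖) ^ q * ‖x - y‖ ^ 2 ≤ c x)
    (x y : E) {t : ℝ} (ht : 0 ≤ t) (ht' : t ≤ 1) :
    c (t • x + (1 - t) • y) ≤ t * c x + (1 - t) * c y
      - (2 * 2 ^ |q| * Λ)⁻¹ * t * (1 - t) * (‖x‖ + ‖y‖) ^ q * ‖x - y‖ ^ 2 := by
  rcases le_total t (1 / 2) with hle | hle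
  · exact uniform_convexity_of_strong_convexity_of_le_half hΛ h x y ht hle
  · have key := uniform_convexity_of_strong_convexity_of_le_half hΛ h y x
      (t := 1 - t) (by linarith) (by linarith)
    rw [sub_sub_cancel, add_comm ((1 - t) • y), add_comm ‖y‖, norm_sub_rev y x] at key
    linarith

/-- Uniform convexity along the segment from `y` to `x`, with modulus `W`, implies the
corresponding first-order inequality at `y`. -/
theorem add_inner_gradient_add_le [CompleteSpace E] {c : E → ℝ} {x y : E} {W : ℝ}
    (hc : DifferentiableAt ℝ c y)
    (h : ∀ t : ℝ, 0 ≤ t → t ≤ 1 →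
      c (t • x + (1 - t) • y) ≤ t * c x + (1 - t) * c y - t * (1 - t) * W) :
    c y + ⟪gradient c y, x - y⟫ + W ≤ c x := by
  have hderiv : HasLineDerivAt ℝ c ⟪gradient c y, x - y⟫ y (x - y) := by
    simpa using hc.hasGradientAt.hasFDerivAt.hasLineDerivAt (x - y)
  have hlim := hderiv.tendsto_slope_zero_right
  have hbound : Filter.Tendsto (fun t : ℝ => c x - c y - (1 - t) * W)
      (nhdsWithin 0 (Set.Ioi 0)) (nhds (c x - c y - (1 - 0) * W)) :=
    ((by fun_prop : Continuous fun t : ℝ => c x - c y - (1 - t) * W).tendsto 0).mono_left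
      nhdsWithin_le_nhds
  have hle := le_of_tendsto_of_tendsto hlim hbound <| by
    filter_upwards [Ioc_mem_nhdsGT (zero_lt_one' ℝ)] with t ht
    have hseg : y + t • (x - y) = t • x + (1 - t) • y := by module
    rw [hseg, smul_eq_mul, inv_mul_le_iff₀ ht.1]
    linarith [h t ht.1.le ht.2]
  linarith

end StrongConvexity

/-- For a convex `C¹` function `c` on `ℝ^d`, the strong convexity
inequality `c(x) ≥ c(y) + ⟨∇c(y), x-y⟩ + Λ⁻¹(|x|+|y|)^(p-2)|x-y|²` is equivalent
(up to changing the constant, the new constant depending only on the old one and `p`)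
to the uniform convexity inequality along segments. -/
theorem strong_convexity_iff_uniform_convexity (d : ℕ) (hd : 1 ≤ d) (p : ℝ) (hp : 1 < p) :
    (∀ Λ : ℝ, 0 < Λ → ∃ Λ' : ℝ, 0 < Λ' ∧
      ∀ c : EuclideanSpace ℝ (Fin d) → ℝ, ConvexOn ℝ Set.univ c → ContDiff ℝ 1 c →
        (∀ x y : EuclideanSpace ℝ (Fin d),
          c y + ⟪gradient c y, x - y⟫ + Λ⁻¹ * (‖x‖ + ‖y‖) ^ (p - 2) * ‖x - y‖ ^ 2 ≤ c x) →
        (∀ x y : EuclideanSpace ℝ (Fin d), ∀ lam : ℝ, 0 ≤ lam → lam ≤ 1 →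
          c (lam • x + (1 - lam) • y) ≤
            lam * c x + (1 - lam) * c y
              - Λ'⁻¹ * lam * (1 - lam) * (‖x‖ + ‖y‖) ^ (p - 2) * ‖x - y‖ ^ 2)) ∧
    (∀ Λ' : ℝ, 0 < Λ' → ∃ Λ : ℝ, 0 < Λ ∧
      ∀ c : EuclideanSpace ℝ (Fin d) → ℝ, ConvexOn ℝ Set.univ c → ContDiff ℝ 1 c →
        (∀ x y : EuclideanSpace ℝ (Fin d), ∀ lam : ℝ, 0 ≤ lam → lam ≤ 1 →
          c (lam • x + (1 - lam) • y) ≤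
            lam * c x + (1 - lam) * c y
              - Λ'⁻¹ * lam * (1 - lam) * (‖x‖ + ‖y‖) ^ (p - 2) * ‖x - y‖ ^ 2) →
        (∀ x y : EuclideanSpace ℝ (Fin d),
          c y + ⟪gradient c y, x - y⟫ + Λ⁻¹ * (‖x‖ + ‖y‖) ^ (p - 2) * ‖x - y‖ ^ 2 ≤ c x)) := by
  refine ⟨fun Λ hΛ => ⟨2 * 2 ^ |p - 2| * Λ, by positivity, fun c _ _ h x y t ht ht' =>
    uniform_convexity_of_strong_convexity hΛ h x y ht ht'⟩,
    fun Λ hΛ => ⟨Λ, hΛ, fun c _ hc h x y => ?_⟩⟩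
  refine add_inner_gradient_add_le (hc.differentiable one_ne_zero y) fun t ht ht' => ?_
  linarith [h x y t ht ht']
end

section
/- Let d ≥ 1 and let c: ℝ^d → ℝ be strictly convex, C¹, and superlinear (i.e. c(x)/|x| → ∞ as |x| → ∞). Then ∇c: ℝ^d → ℝ^d is a homeomorphism of ℝ^d onto ℝ^d. -/
open Filter

section Gradient

variable {E : Type*} [NormedAddCommGroup E] [InnerProductSpace ℝ E]

theorem StrictConvexOn.comp_lineMap {c : E → ℝ} (hc : StrictConvexOn ℝ Set.univ c) {x y : E}
    (hxy : x ≠ y) : StrictConvexOn ℝ Set.univ fun t : ℝ => c (AffineMap.lineMap x y t) := by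
  refine ⟨convex_univ, fun s _ t _ hst a b ha hb hab => ?_⟩
  have hne := (AffineMap.lineMap_injective ℝ hxy).ne hst
  have h := hc.2 (Set.mem_univ _) (Set.mem_univ _) hne ha hb hab
  rwa [← Convex.combo_affine_apply hab] at h

theorem tendsto_sub_inner_cocompact_atTop [ProperSpace E] {c : E → ℝ}
    (hsuper : Tendsto (fun x => c x / ‖x‖) (cocompact E) atTop) (p : E) :
    Tendsto (fun x => c x - inner ℝ p x) (cocompact E) atTop := by
  have hnorm := tendsto_norm_cocompact_atTop (E := E)
  refine tendsto_atTop_mono' _ ?_ hnorm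
  filter_upwards [hsuper.eventually_ge_atTop (‖p‖ + 1), hnorm.eventually_gt_atTop 0] with x h hx
  rw [le_div_iff₀ hx] at h
  linarith [real_inner_le_norm p x]

variable [CompleteSpace E]

theorem StrictConvexOn.add_inner_gradient_lt {c : E → ℝ} (hc : StrictConvexOn ℝ Set.univ c)
    {x y : E} (hd : DifferentiableAt ℝ c x) (hxy : x ≠ y) :
    c x + inner ℝ (gradient c x) (y - x) < c y := by
  have hline : HasDerivAt (fun t : ℝ => c (AffineMap.lineMap x y t))
      (fderiv ℝ c x (y - x)) 0 := by
    refine HasFDerivAt.comp_hasDerivAt (0 : ℝ) ?_ AffineMap.hasDerivAt_lineMap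
    simpa using hd.hasFDerivAt
  have h := (hc.comp_lineMap hxy).lt_slope_of_hasDerivAt (Set.mem_univ 0) (Set.mem_univ 1)
    one_pos hline
  rw [inner_gradient_left]
  simp only [slope_def_field, AffineMap.lineMap_apply_one, AffineMap.lineMap_apply_zero] at h
  linarith

theorem StrictConvexOn.injective_gradient {c : E → ℝ} (hc : StrictConvexOn ℝ Set.univ c)
    (hd : Differentiable ℝ c) : Function.Injective (gradient c) := by
  intro x y h
  by_contra hxy
  have h₁ := hc.add_inner_gradient_lt (hd x) hxy
  have h₂ := hc.add_inner_gradient_lt (hd y) (Ne.symm hxy)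
  rw [← h, ← neg_sub y x, inner_neg_right] at h₂
  linarith

theorem ContDiff.continuous_gradient {c : E → ℝ} (hc : ContDiff ℝ 1 c) :
    Continuous (gradient c) :=
  (InnerProductSpace.toDual ℝ E).symm.continuous.comp (hc.continuous_fderiv one_ne_zero)

variable [ProperSpace E]

theorem surjective_gradient_of_superlinear {c : E → ℝ} (hd : Differentiable ℝ c)
    (hsuper : Tendsto (fun x => c x / ‖x‖) (cocompact E) atTop) :
    Function.Surjective (gradient c) := by
  intro p
  obtain ⟨x, hx⟩ := (hd.continuous.sub (continuous_const.inner continuous_id)).exists_forall_le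
    (tendsto_sub_inner_cocompact_atTop hsuper p)
  refine ⟨x, ?_⟩
  have hderiv : HasFDerivAt (fun z => c z - inner ℝ p z) (fderiv ℝ c x - innerSL ℝ p) x :=
    (hd x).hasFDerivAt.sub (innerSL ℝ p).hasFDerivAt
  have hzero := IsLocalMin.hasFDerivAt_eq_zero (Eventually.of_forall hx) hderiv
  refine ext_inner_right ℝ fun v => ?_
  rw [inner_gradient_left, sub_eq_zero.mp hzero, innerSL_apply_apply]

theorem StrictConvexOn.tendsto_gradient_cocompact {c : E → ℝ}
    (hc : StrictConvexOn ℝ Set.univ c) (hd : Differentiable ℝ c)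
    (hsuper : Tendsto (fun x => c x / ‖x‖) (cocompact E) atTop) :
    Tendsto (gradient c) (cocompact E) (cocompact E) := by
  have hnorm := tendsto_norm_cocompact_atTop (E := E)
  refine tendsto_cocompact_of_tendsto_dist_comp_atTop 0 ?_
  simp only [dist_zero_right]
  refine tendsto_atTop_mono' _ ?_
    (hsuper.atTop_add ((tendsto_const_nhds (x := -c 0)).div_atTop hnorm))
  filter_upwards [hnorm.eventually_gt_atTop 0] with x hx
  have h := hc.add_inner_gradient_lt (hd x) (norm_pos_iff.mp hx)
  rw [zero_sub, inner_neg_right] at h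
  rw [← add_div, div_le_iff₀ hx]
  linarith [real_inner_le_norm (gradient c x) x]

theorem StrictConvexOn.isHomeomorph_gradient {c : E → ℝ} (hc : StrictConvexOn ℝ Set.univ c)
    (hC1 : ContDiff ℝ 1 c) (hsuper : Tendsto (fun x => c x / ‖x‖) (cocompact E) atTop) :
    IsHomeomorph (gradient c) := by
  have hd := hC1.differentiable one_ne_zero
  have hproper : IsProperMap (gradient c) := isProperMap_iff_tendsto_cocompact.mpr
    ⟨hC1.continuous_gradient, hc.tendsto_gradient_cocompact hd hsuper⟩
  exact isHomeomorph_iff_continuous_isClosedMap_bijective.mpr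
    ⟨hproper.continuous, hproper.isClosedMap, hc.injective_gradient hd,
      surjective_gradient_of_superlinear hd hsuper⟩

end Gradient

/-- If `c : ℝ^d → ℝ` is strictly convex, `C¹` and superlinear,
then `∇c` is a homeomorphism of `ℝ^d` onto itself. -/
theorem gradient_homeomorph (d : ℕ) (hd : 1 ≤ d)
    (c : EuclideanSpace ℝ (Fin d) → ℝ)
    (hconv : StrictConvexOn ℝ Set.univ c)
    (hC1 : ContDiff ℝ 1 c)
    (hsuper : Tendsto (fun x : EuclideanSpace ℝ (Fin d) => c x / ‖x‖)
      (cocompact (EuclideanSpace ℝ (Fin d))) atTop) :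
    ∃ e : EuclideanSpace ℝ (Fin d) ≃ₜ EuclideanSpace ℝ (Fin d),
      ∀ x, e x = gradient c x :=
  ⟨(hconv.isHomeomorph_gradient hC1 hsuper).homeomorph, fun _ => rfl⟩
end

section
/- Let d ≥ 1, 1 < p ≤ 2, and let c ∈ C²(ℝ^d \ {0}) satisfy ‖∇²c(z)‖ ≤ Λ |z|^{p−2} for all z ≠ 0, for some Λ > 0. Let η > 0, x̂ ∈ ℝ^d, 0 < r ≤ η/8, and let φ: ℝ^d → ℝ ∪ {+∞} be any function. Define ψ(x) = sup { −φ(y) − c(y − x) : y ∈ ℝ^d, |y − x̂| ≥ η/4 } and assume ψ is finite at every point of B_r(x̂). Then there exists a constant C depending only on Λ and p such that the function x ↦ ψ(x) + (C/2) η^{p−2} |x|² is convex on B_r(x̂); i.e. ψ is semi-convex on B_r(x̂) with semi-convexity constant C η^{p−2}. -/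
open Metric Set
open scoped RealInnerProductSpace

noncomputable section

/-- A function whose derivative is `K`-Lipschitz on a convex set is semi-convex there with
constant `K`. -/
theorem convexOn_add_sq_norm_of_lipschitz_fderiv {E : Type*} [NormedAddCommGroup E]
    [InnerProductSpace ℝ E] {S : Set E} (hS : Convex ℝ S) {f : E → ℝ} {f' : E → E →L[ℝ] ℝ} {K : ℝ}
    (hf : ∀ x ∈ S, HasFDerivAt f (f' x) x)
    (hf' : ∀ x ∈ S, ∀ y ∈ S, ‖f' y - f' x‖ ≤ K * ‖y - x‖) :
    ConvexOn ℝ S (fun x => f x + K / 2 * ‖x‖ ^ 2) := by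
  refine ⟨hS, fun x hx y hy a b ha hb hab => ?_⟩
  set v := y - x with hv
  have hmem : ∀ t ∈ Icc (0 : ℝ) 1, x + t • v ∈ S := fun t ht => hS.add_smul_sub_mem hx hy ht
  set h : ℝ → ℝ := fun t => f (x + t • v) + K / 2 * ‖x + t • v‖ ^ 2 with hh
  have hderiv : ∀ t ∈ Icc (0 : ℝ) 1,
      HasDerivAt h (f' (x + t • v) v + K * ⟪x + t • v, v⟫) t := by
    intro t ht
    have hline : HasDerivAt (fun t : ℝ => x + t • v) v t := by
      simpa using ((hasDerivAt_id t).smul_const v).const_add x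
    have hsq := (hline.norm_sq).const_mul (K / 2)
    refine (((hf _ (hmem t ht)).comp_hasDerivAt t hline).add hsq).congr_deriv ?_
    ring
  have hconv : ConvexOn ℝ (Icc (0 : ℝ) 1) h := by
    refine MonotoneOn.convexOn_of_deriv (convex_Icc 0 1)
      (fun t ht => (hderiv t ht).continuousAt.continuousWithinAt)
      (fun t ht => (hderiv t (interior_subset ht)).differentiableAt.differentiableWithinAt) ?_
    intro s hs t ht hst
    have hs' := interior_subset hs
    have ht' := interior_subset ht
    rw [(hderiv s hs').deriv, (hderiv t ht').deriv]
    have hdiff : x + t • v - (x + s • v) = (t - s) • v := by module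
    have hlip := hf' _ (hmem s hs') _ (hmem t ht')
    rw [hdiff, norm_smul, Real.norm_of_nonneg (sub_nonneg.2 hst)] at hlip
    have hle := (f' (x + t • v) - f' (x + s • v)).le_of_opNorm_le hlip v
    rw [Real.norm_eq_abs, sub_apply] at hle
    have hlow := (abs_le.1 hle).1
    have hinner : ⟪x + t • v, v⟫ - ⟪x + s • v, v⟫ = (t - s) * ‖v‖ ^ 2 := by
      rw [← inner_sub_left, hdiff, real_inner_smul_left, real_inner_self_eq_norm_sq]
    linear_combination hlow - K * hinner
  have key := hconv.2 (left_mem_Icc.2 zero_le_one) (right_mem_Icc.2 zero_le_one) ha hb hab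
  have hcomb : x + b • v = a • x + b • y := by
    rw [hv, eq_sub_of_add_eq hab]
    module
  have hend : x + v = y := add_sub_cancel x y
  simpa [hh, hcomb, hend] using key

/-- If the Hessian of `f` is bounded by `K` on an open convex set, then `f` is semi-convex there
with constant `K`. -/
theorem convexOn_add_sq_norm_of_norm_fderiv_fderiv_le {E : Type*} [NormedAddCommGroup E]
    [InnerProductSpace ℝ E] {S : Set E} (hS : Convex ℝ S) (hSo : IsOpen S) {f : E → ℝ} {K : ℝ}
    (hf : ContDiffOn ℝ 2 f S) (hf' : ∀ x ∈ S, ‖fderiv ℝ (fderiv ℝ f) x‖ ≤ K) :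
    ConvexOn ℝ S (fun x => f x + K / 2 * ‖x‖ ^ 2) := by
  have hC : ContDiffOn ℝ 1 (fderiv ℝ f) S := hf.fderiv_of_isOpen hSo (by norm_num)
  refine convexOn_add_sq_norm_of_lipschitz_fderiv hS (f' := fderiv ℝ f)
    (fun x hx => ((hf.differentiableOn (by norm_num)).differentiableAt
      (hSo.mem_nhds hx)).hasFDerivAt) fun x hx y hy => ?_
  exact hS.norm_image_sub_le_of_norm_fderiv_le
    (fun z hz => (hC.differentiableOn (by norm_num)).differentiableAt (hSo.mem_nhds hz)) hf' hx hy

theorem fderiv_comp_const_sub {E F : Type*} [NormedAddCommGroup E] [NormedSpace ℝ E]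
    [NormedAddCommGroup F] [NormedSpace ℝ F] (f : E → F) (y x : E) :
    fderiv ℝ (fun x => f (y - x)) x = -fderiv ℝ f (y - x) := by
  have h := (ContinuousLinearEquiv.neg ℝ (M := E)).comp_right_fderiv
    (f := fun u => f (y + u)) (x := x)
  rw [fderiv_comp_add_left] at h
  ext v
  simpa [Function.comp_def, sub_eq_add_neg] using DFunLike.congr_fun h v

/-- Semi-convexity of `-c (y - ·)` is inherited from a Hessian bound of `c` on a reflected set. -/
theorem convexOn_neg_comp_sub_add_sq_norm {E : Type*} [NormedAddCommGroup E]
    [InnerProductSpace ℝ E] {S T : Set E} (hS : Convex ℝ S) (hSo : IsOpen S) {c : E → ℝ} {K : ℝ}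
    (y : E) (hc : ContDiffOn ℝ 2 c T) (hST : ∀ x ∈ S, y - x ∈ T)
    (hc' : ∀ x ∈ S, ‖fderiv ℝ (fderiv ℝ c) (y - x)‖ ≤ K) :
    ConvexOn ℝ S (fun x => -c (y - x) + K / 2 * ‖x‖ ^ 2) := by
  refine convexOn_add_sq_norm_of_norm_fderiv_fderiv_le hS hSo
    (hc.comp (contDiff_const.sub contDiff_id).contDiffOn hST).neg fun x hx => ?_
  have h1 : fderiv ℝ (fun x => -c (y - x)) = fun x => fderiv ℝ c (y - x) := by
    ext1 x
    rw [fderiv_fun_neg, fderiv_comp_const_sub, neg_neg]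
  rw [h1, fderiv_comp_const_sub]
  exact (norm_neg (fderiv ℝ (fderiv ℝ c) (y - x))).trans_le (hc' x hx)

/-- Let `1 < p ≤ 2` and let `c ∈ C²(ℝ^d \ {0})` satisfy
`‖∇²c(z)‖ ≤ Λ|z|^(p-2)` for `z ≠ 0`.  Let `η > 0`, `x̂ ∈ ℝ^d`, `0 < r ≤ η/8`, and
let `φ : ℝ^d → ℝ ∪ {+∞}` be any function (valued in `EReal`, never `-∞`).
Define `ψ(x) = sup { -φ(y) - c(y - x) : |y - x̂| ≥ η/4 }` (the supremum of the set
`V x` of real values attained) and assume `ψ` is finite on `B_r(x̂)` (i.e. `V x`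
is nonempty and bounded above there).  Then there is a constant `C` depending
only on `Λ` and `p` such that `x ↦ ψ(x) + (C/2) η^(p-2) |x|²` is convex on
`B_r(x̂)`. -/
theorem semiconvexity_of_sup (d : ℕ) (hd : 1 ≤ d) (p Λ : ℝ)
    (hp : 1 < p) (hp2 : p ≤ 2) (hΛ : 0 < Λ) :
    ∃ C : ℝ, 0 < C ∧
      ∀ c : EuclideanSpace ℝ (Fin d) → ℝ,
        ContDiffOn ℝ 2 c {0}ᶜ →
        (∀ z : EuclideanSpace ℝ (Fin d), z ≠ 0 →
          ‖fderiv ℝ (fderiv ℝ c) z‖ ≤ Λ * ‖z‖ ^ (p - 2)) →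
      ∀ η : ℝ, 0 < η →
      ∀ (xhat : EuclideanSpace ℝ (Fin d)) (r : ℝ), 0 < r → r ≤ η / 8 →
      ∀ φ : EuclideanSpace ℝ (Fin d) → EReal, (∀ y, φ y ≠ ⊥) →
      ∀ V : EuclideanSpace ℝ (Fin d) → Set ℝ,
        (∀ x, V x = {v : ℝ | ∃ y : EuclideanSpace ℝ (Fin d),
          η / 4 ≤ ‖y - xhat‖ ∧ (v : EReal) = -φ y - (c (y - x) : EReal)}) →
        (∀ x ∈ ball xhat r, (V x).Nonempty ∧ BddAbove (V x)) →
      ConvexOn ℝ (ball xhat r)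
        (fun x => sSup (V x) + C / 2 * η ^ (p - 2) * ‖x‖ ^ 2) := by
  refine ⟨Λ * 8 ^ (2 - p), by positivity, ?_⟩
  intro c hc hc' η hη xhat r hr hrη φ hφ V hV hfin
  set K := Λ * 8 ^ (2 - p) * η ^ (p - 2) with hK
  have hrpow : (η / 8) ^ (p - 2) = 8 ^ (2 - p) * η ^ (p - 2) := by
    rw [Real.div_rpow hη.le (by norm_num), ← neg_sub 2 p, Real.rpow_neg (by norm_num : (0 : ℝ) ≤ 8),
      div_inv_eq_mul, mul_comm]
  have hconv : ∀ y, η / 4 ≤ ‖y - xhat‖ →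
      ConvexOn ℝ (ball xhat r) (fun x => -c (y - x) + K / 2 * ‖x‖ ^ 2) := by
    intro y hy
    have hfar : ∀ x ∈ ball xhat r, η / 8 ≤ ‖y - x‖ := by
      intro x hx
      rw [mem_ball, dist_eq_norm] at hx
      have := norm_sub_le_norm_sub_add_norm_sub y x xhat
      linarith
    have hne : ∀ x ∈ ball xhat r, y - x ≠ 0 := fun x hx =>
      norm_pos_iff.1 ((by positivity : 0 < η / 8).trans_le (hfar x hx))
    refine convexOn_neg_comp_sub_add_sq_norm (convex_ball xhat r) isOpen_ball y hc hne
      fun x hx => (hc' _ (hne x hx)).trans ?_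
    rw [hK, mul_assoc, ← hrpow]
    exact mul_le_mul_of_nonneg_left
      (Real.rpow_le_rpow_of_nonpos (by positivity) (hfar x hx) (by linarith)) hΛ.le
  refine ⟨convex_ball xhat r, fun x hx z hz a b ha hb hab => ?_⟩
  have hw := convex_ball xhat r hx hz ha hb hab
  have hKC : Λ * 8 ^ (2 - p) / 2 * η ^ (p - 2) = K / 2 := by rw [hK]; ring
  simp only [hKC, smul_eq_mul]
  rw [← le_sub_iff_add_le]
  refine csSup_le (hfin _ hw).1 fun v hv => ?_
  rw [hV] at hv
  obtain ⟨y, hy, hvy⟩ := hv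
  have htop : φ y ≠ ⊤ := by
    intro h
    simp [h] at hvy
  lift φ y to ℝ using ⟨htop, hφ y⟩ with q hq
  have hval : v = -q - c (y - (a • x + b • z)) := by exact_mod_cast hvy
  have hle : ∀ u ∈ ball xhat r, -q - c (y - u) ≤ sSup (V u) := by
    intro u hu
    refine le_csSup (hfin u hu).2 ?_
    rw [hV]
    exact ⟨y, hy, by rw [← hq]; norm_cast⟩
  have hcx := (hconv y hy).2 hx hz ha hb hab
  simp only [smul_eq_mul] at hcx
  have hx' := mul_le_mul_of_nonneg_left (hle x hx) ha
  have hz' := mul_le_mul_of_nonneg_left (hle z hz) hb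
  rw [hval]
  linear_combination hcx + hx' + hz' + q * hab
end
end
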